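/- arXiv:2003.03806 — 4 statements merged into one kernel-verified Lean document; each statement's English description precedes it below -/
import Mathlib

section
/- Let a < b be real numbers and let f : [a,b] → ℝ be continuously differentiable with f(a) = f(b) = 0. Then sup_{x ∈ [a,b]} |f(x)| ≤ ( ‖f‖_{L²} · ‖f'‖_{L²} )^{1/2}, i.e. for every x ∈ [a,b] one has f(x)² ≤ (∫_a^b f(s)² ds)^{1/2} · (∫_a^b f'(s)² ds)^{1/2}. -/
open Set MeasureTheory

/-- **Cauchy–Schwarz inequality** for interval integrals of continuous functions. -/
theorem intervalIntegral_mul_le_sqrt_mul_sqrt {a b : ℝ} (hab : a ≤ b) {u v : ℝ → ℝ}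
    (hu : Continuous u) (hv : Continuous v) :
    ∫ s in a..b, u s * v s ≤ √(∫ s in a..b, u s ^ 2) * √(∫ s in a..b, v s ^ 2) := by
  have hquad (t : ℝ) : 0 ≤ (∫ s in a..b, u s ^ 2) * (t * t)
      + (2 * ∫ s in a..b, u s * v s) * t + ∫ s in a..b, v s ^ 2 := by
    have hexpand : ∫ s in a..b, (t * u s + v s) ^ 2 = (∫ s in a..b, u s ^ 2) * (t * t)
        + (2 * ∫ s in a..b, u s * v s) * t + ∫ s in a..b, v s ^ 2 := by
      rw [← intervalIntegral.integral_const_mul, ← intervalIntegral.integral_mul_const,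
        ← intervalIntegral.integral_mul_const, ← intervalIntegral.integral_add,
        ← intervalIntegral.integral_add]
      · congr 1 with s
        ring
      all_goals exact Continuous.intervalIntegrable (by fun_prop) _ _
    rw [← hexpand]
    exact intervalIntegral.integral_nonneg hab fun s _ => sq_nonneg _
  have hdiscrim := discrim_le_zero hquad
  rw [discrim] at hdiscrim
  rw [← Real.sqrt_mul (intervalIntegral.integral_nonneg hab fun s _ => sq_nonneg _)]
  exact Real.le_sqrt_of_sq_le (by linarith)

/-- The increment of `f ^ 2` is controlled by the integral of `|f| * |f'|`. -/
theorem abs_sq_sub_sq_le_integral {f : ℝ → ℝ} (hf : ContDiff ℝ 1 f) {c d : ℝ} (hcd : c ≤ d) :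
    |f d ^ 2 - f c ^ 2| ≤ 2 * ∫ s in c..d, |f s| * |deriv f s| := by
  have hcont := hf.continuous
  have hcont_deriv : Continuous (deriv f) := hf.continuous_deriv le_rfl
  have hftc : ∫ s in c..d, 2 * (f s * deriv f s) = f d ^ 2 - f c ^ 2 := by
    refine intervalIntegral.integral_eq_sub_of_hasDerivAt (f := fun s => f s ^ 2)
      (fun s _ => ?_) (Continuous.intervalIntegrable (by fun_prop) _ _)
    exact ((hf.differentiable one_ne_zero s).hasDerivAt.fun_pow 2).congr_deriv (by
      push_cast
      ring)
  rw [← hftc, intervalIntegral.integral_const_mul, abs_mul, abs_two]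
  gcongr
  simpa only [abs_mul] using intervalIntegral.abs_integral_le_integral_abs
    (f := fun s => f s * deriv f s) (μ := volume) hcd

/-- **Agmon's inequality with zero boundary conditions.**
If `f : [a,b] → ℝ` is continuously differentiable with `f a = f b = 0`, then for every
`x ∈ [a,b]` one has `f(x)² ≤ (∫_a^b f²)^{1/2} · (∫_a^b f'²)^{1/2}`, i.e.
`sup |f| ≤ (‖f‖_{L²} ‖f'‖_{L²})^{1/2}`. -/
theorem agmon_zero_bc (a b : ℝ) (hab : a < b) (f : ℝ → ℝ)
    (hf : ContDiff ℝ 1 f) (ha : f a = 0) (hb : f b = 0) :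
    ∀ x ∈ Icc a b,
      f x ^ 2 ≤ Real.sqrt (∫ s in a..b, f s ^ 2) * Real.sqrt (∫ s in a..b, deriv f s ^ 2) := by
  intro x hx
  have hcont := hf.continuous
  have hcont_deriv : Continuous (deriv f) := hf.continuous_deriv le_rfl
  have hint (c d : ℝ) : IntervalIntegrable (fun s => |f s| * |deriv f s|) volume c d :=
    Continuous.intervalIntegrable (by fun_prop) _ _
  have hleft := (le_abs_self _).trans (abs_sq_sub_sq_le_integral hf hx.1)
  have hright := (neg_le_abs _).trans (abs_sq_sub_sq_le_integral hf hx.2)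
  have hsplit := intervalIntegral.integral_add_adjacent_intervals (hint a x) (hint x b)
  have hcs := intervalIntegral_mul_le_sqrt_mul_sqrt hab.le hcont.abs hcont_deriv.abs
  simp only [sq_abs] at hcs
  rw [ha] at hleft
  rw [hb] at hright
  linarith
end

section
/- Let a < b be real numbers and let f : [a,b] → ℝ be continuously differentiable. Then sup_{x ∈ [a,b]} |f(x)| ≤ (2 ‖f‖_{L²} · ‖f'‖_{L²})^{1/2} + ( (1/(b−a)) ∫_a^b f(s)² ds )^{1/2}. -/
open Set MeasureTheory

/-- The Cauchy–Schwarz inequality for continuous functions on a compact interval. -/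
lemma integral_abs_mul_le_sqrt_mul_sqrt {a b : ℝ} (hab : a ≤ b) {f g : ℝ → ℝ}
    (hf : Continuous f) (hg : Continuous g) :
    ∫ s in a..b, |f s * g s| ≤
      Real.sqrt (∫ s in a..b, f s ^ 2) * Real.sqrt (∫ s in a..b, g s ^ 2) := by
  have memLp_two {h : ℝ → ℝ} (hh : Continuous h) :
      MemLp h (ENNReal.ofReal 2) (volume.restrict (Ioc a b)) := by
    rw [ENNReal.ofReal_ofNat, memLp_two_iff_integrable_sq hh.aestronglyMeasurable]
    exact (hh.pow 2).integrableOn_Ioc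
  have key := integral_mul_norm_le_Lp_mul_Lq Real.HolderConjugate.two_two (memLp_two hf)
    (memLp_two hg)
  simp only [intervalIntegral.integral_of_le hab, abs_mul, Real.sqrt_eq_rpow]
  simpa only [Real.norm_eq_abs, Real.rpow_two, sq_abs] using key

/-- The squares of a `C¹` function at two points of `[a, b]` differ by at most
`2 ‖f‖_{L²} ‖f'‖_{L²}`. -/
lemma sq_sub_sq_le_two_mul_sqrt_mul_sqrt {a b c x : ℝ} {f : ℝ → ℝ}
    (hf : ContDiff ℝ 1 f) (hc : c ∈ Icc a b) (hx : x ∈ Icc a b) :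
    f x ^ 2 - f c ^ 2 ≤ 2 * Real.sqrt (∫ s in a..b, f s ^ 2)
      * Real.sqrt (∫ s in a..b, deriv f s ^ 2) := by
  have hab : a ≤ b := hc.1.trans hc.2
  have hf' : Continuous (deriv f) := hf.continuous_deriv le_rfl
  have hcont : Continuous fun s => f s * deriv f s := hf.continuous.mul hf'
  have ftc : ∫ s in c..x, 2 * (f s * deriv f s) = f x ^ 2 - f c ^ 2 := by
    refine intervalIntegral.integral_eq_sub_of_hasDerivAt (f := fun s => f s ^ 2) (fun s _ => ?_)
      ((continuous_const.mul hcont).intervalIntegrable _ _)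
    have h := ((hf.differentiable one_ne_zero s).hasDerivAt).fun_pow 2
    simpa [mul_assoc] using h
  have hsub : uIoc c x ⊆ uIoc a b := by
    rw [uIoc_of_le hab]
    exact Ioc_subset_Ioc (le_min hc.1 hx.1) (max_le hc.2 hx.2)
  calc f x ^ 2 - f c ^ 2 = 2 * ∫ s in c..x, f s * deriv f s := by
        rw [← ftc, intervalIntegral.integral_const_mul]
    _ ≤ 2 * |(∫ s in a..b, |f s * deriv f s|)| := by
        gcongr
        calc ∫ s in c..x, f s * deriv f s ≤ |(∫ s in c..x, f s * deriv f s)| := le_abs_self _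
          _ ≤ |(∫ s in c..x, |f s * deriv f s|)| :=
              intervalIntegral.norm_integral_le_abs_integral_norm (f := fun s => f s * deriv f s)
          _ ≤ _ := intervalIntegral.abs_integral_mono_interval hsub
              (Filter.Eventually.of_forall fun _ => abs_nonneg _)
              (hcont.abs.intervalIntegrable _ _)
    _ ≤ 2 * (Real.sqrt (∫ s in a..b, f s ^ 2) * Real.sqrt (∫ s in a..b, deriv f s ^ 2)) := by
        rw [abs_of_nonneg (intervalIntegral.integral_nonneg hab fun _ _ => abs_nonneg _)]
        gcongr
        exact integral_abs_mul_le_sqrt_mul_sqrt hab hf.continuous hf'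
    _ = _ := (mul_assoc _ _ _).symm

/-- **Agmon's inequality without boundary conditions.**
If `f : [a,b] → ℝ` is continuously differentiable, then
`sup_{x ∈ [a,b]} |f(x)| ≤ (2 ‖f‖_{L²} ‖f'‖_{L²})^{1/2} + ((1/(b−a)) ∫_a^b f²)^{1/2}`. -/
theorem agmon_no_bc (a b : ℝ) (hab : a < b) (f : ℝ → ℝ) (hf : ContDiff ℝ 1 f) :
    ∀ x ∈ Icc a b,
      |f x| ≤ Real.sqrt (2 * Real.sqrt (∫ s in a..b, f s ^ 2)
            * Real.sqrt (∫ s in a..b, deriv f s ^ 2))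
          + Real.sqrt ((1 / (b - a)) * ∫ s in a..b, f s ^ 2) := by
  intro x hx
  obtain ⟨c, hc, hmean⟩ := exists_eq_interval_average (f := fun s => f s ^ 2) hab.ne
    (hf.continuous.pow 2).continuousOn
  rw [uIoo_of_le hab.le] at hc
  rw [interval_average_eq, smul_eq_mul, ← one_div] at hmean
  have key := sq_sub_sq_le_two_mul_sqrt_mul_sqrt hf (Ioo_subset_Icc_self hc) hx
  rw [← hmean, ← Real.sqrt_sq_eq_abs]
  refine Real.sqrt_le_iff.2 ⟨by positivity, ?_⟩
  rw [add_sq, Real.sq_sqrt (by positivity), Real.sq_sqrt (sq_nonneg _)]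
  exact (sub_le_iff_le_add.1 key).trans
    (add_le_add_left (le_add_of_nonneg_right (by positivity)) _)
end

section
/- Let E be a real Banach space and let P ⊆ E be a nonempty closed convex subset such that λ • x ∈ P whenever x ∈ P and λ ∈ [0,1]. Let A : P → P be continuous and compact, in the sense that A maps bounded subsets of P to sets whose closure in E is compact. If the set { x ∈ P : there exists λ ∈ [0,1] with x = λ • A x } is bounded in E, then A has a fixed point in P, i.e. there exists x ∈ P with A x = x. -/
open Set Metric MeasureTheory Filter Topology

open Polynomial in
theorem exists_det_one_add_interpolation {F : Type*} [NormedAddCommGroup F] [NormedSpace ℝ F]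
    [FiniteDimensional ℝ F] {δ : ℝ} (hδ : 0 < δ) :
    ∃ (s : Finset ℝ) (c : ℝ → ℝ), (∀ t ∈ s, t ∈ Ioo 0 δ) ∧ ∑ t ∈ s, c t = 1 ∧
      ∀ M : F →L[ℝ] F, (1 + M).det = ∑ t ∈ s, c t * (1 + t • M).det := by
  obtain ⟨s, hs, hcard⟩ :=
    (Ioo_infinite hδ).exists_subset_card_eq (Module.finrank ℝ F + 1)
  have hinj : Set.InjOn (id : ℝ → ℝ) s := Function.injective_id.injOn
  have key : ∀ p : ℝ[X], p.natDegree ≤ Module.finrank ℝ F →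
      p.eval 1 = ∑ t ∈ s, (Lagrange.basis s id t).eval 1 * p.eval t := by
    intro p hp
    have hdeg : p.degree < s.card := by
      refine (natDegree_le_iff_degree_le.1 hp).trans_lt ?_
      rw [hcard]
      exact_mod_cast Nat.lt_succ_self _
    conv_lhs => rw [Lagrange.eq_interpolate hinj hdeg]
    simp [Lagrange.interpolate_apply, eval_finsetSum, mul_comm]
  refine ⟨s, fun t => (Lagrange.basis s id t).eval 1, fun t ht => hs ht, ?_, fun M => ?_⟩
  · simpa using (key 1 (by simp)).symm
  · let b := Module.finBasis ℝ F
    let N := LinearMap.toMatrix b b (M : F →ₗ[ℝ] F)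
    have hev : ∀ t : ℝ, (1 + t • M).det =
        (Matrix.det ((X : ℝ[X]) • N.map C + (1 : Matrix _ _ ℝ).map C)).eval t := by
      intro t
      rw [ContinuousLinearMap.det, ← LinearMap.det_toMatrix b, eval_det]
      congr 1
      ext i j
      simp [N, LinearMap.toMatrix_apply, Matrix.one_apply, Finsupp.single_apply, add_comm,
        mul_comm, eq_comm]
    have := key _ ((natDegree_det_X_add_C_le N 1).trans (by simp))
    simp only [← hev] at this
    simpa using this

theorem LipschitzOnWith.lipschitzWith_of_eqOn_zero_compl_ball {F G : Type*}
    [NormedAddCommGroup F] [NormedSpace ℝ F] [NormedAddCommGroup G] {K : NNReal} {g : F → G}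
    (hg : LipschitzOnWith K g (closedBall 0 1)) (hzero : ∀ x, 1 ≤ ‖x‖ → g x = 0) :
    LipschitzWith K g := by
  have mixed : ∀ x y : F, ‖x‖ ≤ 1 → 1 ≤ ‖y‖ → dist (g x) (g y) ≤ K * dist x y := by
    intro x y hx hy
    have hc : Continuous fun t : ℝ => ‖AffineMap.lineMap x y t‖ := by fun_prop
    obtain ⟨t, ht, hz⟩ := intermediate_value_Icc zero_le_one hc.continuousOn
      (show (1 : ℝ) ∈ Icc _ _ by simpa using ⟨hx, hy⟩)
    set z : F := AffineMap.lineMap x y t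
    have hz : ‖z‖ = 1 := hz
    rw [hzero y hy, ← hzero z hz.ge]
    refine (hg.dist_le_mul x (by simpa using hx) z (by simp [hz])).trans ?_
    have : dist x z ≤ dist x y := by
      rw [dist_left_lineMap, Real.norm_of_nonneg ht.1]
      exact mul_le_of_le_one_left dist_nonneg ht.2
    gcongr
  refine LipschitzWith.of_dist_le_mul fun x y => ?_
  rcases le_total ‖x‖ 1 with hx | hx <;> rcases le_total ‖y‖ 1 with hy | hy
  · exact hg.dist_le_mul x (by simpa using hx) y (by simpa using hy)
  · exact mixed x y hx hy
  · rw [dist_comm, dist_comm x]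
    exact mixed y x hy hx
  · rw [hzero x hx, hzero y hy, dist_self]
    positivity

theorem LipschitzWith.bijective_id_add {F : Type*} [NormedAddCommGroup F] [NormedSpace ℝ F]
    [CompleteSpace F] {c : NNReal} {g : F → F} (hg : LipschitzWith c g) (hc : c < 1) :
    Function.Bijective fun x => x + g x := by
  have happrox : ApproximatesLinearOn (fun x => x + g x)
      (ContinuousLinearEquiv.refl ℝ F : F →L[ℝ] F) univ c := by
    rw [ApproximatesLinearOn.approximatesLinearOn_iff_lipschitzOnWith, lipschitzOnWith_univ]
    convert hg using 1
    ext x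
    simp
  have hcsymm : Subsingleton F ∨
      c < ‖((ContinuousLinearEquiv.refl ℝ F).symm : F →L[ℝ] F)‖₊⁻¹ := by
    rcases subsingleton_or_nontrivial F with h | h
    · exact Or.inl h
    · right
      simpa [ContinuousLinearEquiv.refl_symm, ContinuousLinearEquiv.coe_refl] using hc
  exact ⟨injOn_univ.1 (happrox.injOn hcsymm), happrox.surjective hcsymm⟩

/-- A perturbation of the identity which is small in the Lipschitz sense and supported in the unit
ball permutes the unit ball, hence preserves its volume. -/
theorem setIntegral_det_one_add_eq_measureReal_ball {F : Type*} [NormedAddCommGroup F]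
    [NormedSpace ℝ F] [FiniteDimensional ℝ F] [MeasurableSpace F] [BorelSpace F]
    (μ : Measure F) [μ.IsAddHaarMeasure] {c : NNReal} (hc : c < 1) {g : F → F}
    {g' : F → F →L[ℝ] F} (hg : LipschitzWith c g) (hzero : ∀ x, 1 ≤ ‖x‖ → g x = 0)
    (hg' : ∀ x ∈ ball (0 : F) 1, HasFDerivAt g (g' x) x)
    (hpos : ∀ x ∈ ball (0 : F) 1, 0 < (1 + g' x).det) :
    IntegrableOn (fun x => (1 + g' x).det) (ball 0 1) μ ∧
      ∫ x in ball 0 1, (1 + g' x).det ∂μ = μ.real (ball 0 1) := by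
  have hbij := hg.bijective_id_add hc
  have himage : (fun x => x + g x) '' ball 0 1 = ball 0 1 := by
    have hfix : ∀ x, x ∉ ball (0 : F) 1 → x + g x = x := fun x hx => by
      rw [hzero x (by simpa using hx), add_zero]
    ext y
    constructor
    · rintro ⟨x, hx, rfl⟩
      by_contra hy
      exact hy (by simpa [hbij.1 (hfix _ hy)] using hx)
    · intro hy
      obtain ⟨x, rfl⟩ := hbij.2 y
      refine ⟨x, ?_, rfl⟩
      by_contra hx
      exact hx (by simpa [hfix x hx] using hy)
  have hderiv : ∀ x ∈ ball (0 : F) 1,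
      HasFDerivWithinAt (fun x => x + g x) (1 + g' x) (ball 0 1) x := fun x hx =>
    ((hasFDerivAt_id x).add (hg' x hx)).hasFDerivWithinAt
  have habs : EqOn (fun x => |(1 + g' x).det| • (1 : ℝ)) (fun x => (1 + g' x).det)
      (ball 0 1) := fun x hx => by simp [abs_of_pos (hpos x hx)]
  constructor
  · have := (integrableOn_image_iff_integrableOn_abs_det_fderiv_smul μ measurableSet_ball hderiv
      hbij.1.injOn (fun _ => (1 : ℝ))).1 (by
        rw [himage]
        exact integrableOn_const measure_ball_lt_top.ne)
    exact this.congr_fun habs measurableSet_ball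
  · have := integral_image_eq_integral_abs_det_fderiv_smul μ measurableSet_ball hderiv
      hbij.1.injOn (fun _ => (1 : ℝ))
    rw [himage, setIntegral_congr_fun measurableSet_ball habs] at this
    simpa using this.symm

/-- There is no continuously differentiable retraction of the closed unit ball onto the sphere. -/
theorem not_exists_contDiffAt_retraction_sphere {F : Type*} [NormedAddCommGroup F]
    [InnerProductSpace ℝ F] [FiniteDimensional ℝ F] :
    ¬ ∃ r : F → F, (∀ x ∈ closedBall (0 : F) 1, ContDiffAt ℝ 1 r x) ∧
      (∀ x ∈ closedBall (0 : F) 1, ‖r x‖ = 1) ∧ ∀ x ∈ sphere (0 : F) 1, r x = x := by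
  rintro ⟨r, hr, hnorm, hid⟩
  borelize F
  let μ : Measure F := Measure.addHaar
  have hdet : ∀ x ∈ ball (0 : F) 1, (fderiv ℝ r x).det = 0 := by
    intro x hx
    have hx' := ball_subset_closedBall hx
    have hd := ((hr x hx').differentiableAt one_ne_zero).hasFDerivAt
    have hconst : (fun y => inner ℝ (r y) (r y)) =ᶠ[𝓝 x] fun _ => (1 : ℝ) := by
      filter_upwards [isOpen_ball.mem_nhds hx] with y hy
      rw [real_inner_self_eq_norm_sq, hnorm y (ball_subset_closedBall hy), one_pow]
    have hzero := (hd.inner ℝ hd).unique ((hasFDerivAt_const (1 : ℝ) x).congr_of_eventuallyEq hconst)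
    have horth : ∀ v, inner ℝ (r x) (fderiv ℝ r x v) = 0 := by
      intro v
      have := DFunLike.congr_fun hzero v
      simpa [real_inner_comm] using this
    by_contra hne
    obtain ⟨v, hv⟩ := (LinearMap.equivOfDetNeZero _ hne).surjective (r x)
    have hv : fderiv ℝ r x v = r x := hv
    have := horth v
    rw [hv, real_inner_self_eq_norm_sq, hnorm x hx'] at this
    norm_num at this
  let g : F → F := fun x => if ‖x‖ ≤ 1 then r x - x else 0
  have hgzero : ∀ x, 1 ≤ ‖x‖ → g x = 0 := by
    intro x hx
    simp only [g]
    split_ifs with h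
    · rw [hid x (by simpa using le_antisymm h hx), sub_self]
    · rfl
  obtain ⟨K, hK⟩ : ∃ K, LipschitzWith K g := by
    obtain ⟨K, hK⟩ := ContDiffOn.exists_lipschitzOnWith (n := 1) (f := fun x => r x - x)
      (fun x hx => ((hr x hx).sub contDiffAt_id).contDiffWithinAt) one_ne_zero
      (convex_closedBall (0 : F) 1) (isCompact_closedBall 0 1)
    refine ⟨K, LipschitzOnWith.lipschitzWith_of_eqOn_zero_compl_ball ?_ hgzero⟩
    have hEq : EqOn g (fun x => r x - x) (closedBall 0 1) := fun x hx =>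
      if_pos (by simpa using hx)
    intro x hx y hy
    rw [hEq hx, hEq hy]
    exact hK hx hy
  have hgderiv : ∀ x ∈ ball (0 : F) 1, HasFDerivAt g (fderiv ℝ r x - 1) x := by
    intro x hx
    have hd := ((hr x (ball_subset_closedBall hx)).differentiableAt one_ne_zero).hasFDerivAt
    refine (hd.sub (hasFDerivAt_id x)).congr_of_eventuallyEq ?_
    filter_upwards [isOpen_ball.mem_nhds hx] with y hy
    simp only [g]
    rw [if_pos (by simpa using (mem_ball_zero_iff.1 hy).le)]
    rfl
  obtain ⟨η, hη, hηpos⟩ : ∃ η > 0, ∀ M : F →L[ℝ] F, ‖M‖ < η → 0 < (1 + M).det := by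
    have hc : Continuous fun M : F →L[ℝ] F => (1 + M).det :=
      ContinuousLinearMap.continuous_det.comp (continuous_const.add continuous_id)
    have h0 : ∀ᶠ M in 𝓝 (0 : F →L[ℝ] F), 0 < (1 + M).det :=
      hc.continuousAt.eventually (lt_mem_nhds (by simp [ContinuousLinearMap.det]))
    obtain ⟨η, hη, h⟩ := Metric.eventually_nhds_iff.1 h0
    exact ⟨η, hη, fun M hM => h (by simpa using hM)⟩
  obtain ⟨s, c, hs, hc, hinterp⟩ := exists_det_one_add_interpolation (F := F)
    (δ := min η 1 / (K + 1)) (by positivity)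
  have hmain : ∀ t ∈ s,
      IntegrableOn (fun x => (1 + t • (fderiv ℝ r x - 1)).det) (ball 0 1) μ ∧
      ∫ x in ball 0 1, (1 + t • (fderiv ℝ r x - 1)).det ∂μ = μ.real (ball 0 1) := by
    intro t ht
    obtain ⟨ht0, htδ⟩ := hs t ht
    have hbound : t * K < min η 1 := by
      rw [lt_div_iff₀ (by positivity)] at htδ
      linarith
    lift t to NNReal using ht0.le
    refine setIntegral_det_one_add_eq_measureReal_ball μ (c := t * K) (g := fun x => (t : ℝ) • g x)
      ?_ ?_ ?_ ?_ ?_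
    · exact_mod_cast hbound.trans_le (min_le_right _ _)
    · refine LipschitzWith.of_dist_le_mul fun x y => ?_
      rw [dist_smul₀, NNReal.coe_mul, mul_assoc, Real.norm_of_nonneg t.coe_nonneg]
      gcongr
      exact hK.dist_le_mul x y
    · intro x hx
      simp [hgzero x hx]
    · exact fun x hx => (hgderiv x hx).const_smul _
    · intro x hx
      refine hηpos _ ?_
      rw [norm_smul, Real.norm_of_nonneg t.coe_nonneg]
      refine lt_of_le_of_lt ?_ (hbound.trans_le (min_le_left _ _))
      gcongr
      exact (hgderiv x hx).le_of_lipschitz hK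
  have hvol : ∫ x in ball (0 : F) 1, (fderiv ℝ r x).det ∂μ = μ.real (ball 0 1) := by
    calc ∫ x in ball (0 : F) 1, (fderiv ℝ r x).det ∂μ
        = ∫ x in ball (0 : F) 1, ∑ t ∈ s, c t * (1 + t • (fderiv ℝ r x - 1)).det ∂μ := by
          simp only [← hinterp, add_sub_cancel]
      _ = ∑ t ∈ s, c t * μ.real (ball 0 1) := by
          rw [integral_finsetSum _ fun t ht => (hmain t ht).1.const_mul _]
          exact Finset.sum_congr rfl fun t ht => by rw [integral_const_mul, (hmain t ht).2]
      _ = μ.real (ball 0 1) := by rw [← Finset.sum_mul, hc, one_mul]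
  rw [setIntegral_congr_fun measurableSet_ball hdet] at hvol
  have : 0 < μ.real (ball (0 : F) 1) :=
    ENNReal.toReal_pos (measure_ball_pos μ 0 one_pos).ne' measure_ball_lt_top.ne
  simp at hvol
  linarith

/-- **Brouwer's fixed point theorem** for continuously differentiable maps into the unit ball. -/
theorem exists_eq_self_of_contDiff_of_norm_le_one {F : Type*} [NormedAddCommGroup F]
    [InnerProductSpace ℝ F] [FiniteDimensional ℝ F] {h : F → F} (hh : ContDiff ℝ 1 h)
    (hle : ∀ x, ‖h x‖ ≤ 1) : ∃ x, h x = x := by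
  by_contra! hne
  let u : F → F := fun x => x - h x
  let a : F → ℝ := fun x => inner ℝ x (u x)
  let d : F → ℝ := fun x => a x ^ 2 + ‖u x‖ ^ 2 * (1 - ‖x‖ ^ 2)
  have hu : ∀ x, 0 < ‖u x‖ := fun x => norm_pos_iff.2 (sub_ne_zero.2 (hne x).symm)
  have ha : ∀ x, ‖x‖ = 1 → 0 < a x := by
    intro x hx
    have h1 : ‖u x‖ ^ 2 = ‖x‖ ^ 2 - 2 * inner ℝ x (h x) + ‖h x‖ ^ 2 := norm_sub_sq_real x (h x)
    have h2 : a x = ‖x‖ ^ 2 - inner ℝ x (h x) := by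
      simp only [a, u, inner_sub_right, real_inner_self_eq_norm_sq]
    have h3 : ‖h x‖ ^ 2 ≤ 1 := pow_le_one₀ (norm_nonneg _) (hle x)
    have h4 := pow_pos (hu x) 2
    rw [hx] at h1 h2
    linarith
  have hd : ∀ x, ‖x‖ ≤ 1 → 0 < d x := by
    intro x hx
    have h2 := pow_pos (hu x) 2
    rcases hx.lt_or_eq with hlt | heq
    · have : ‖x‖ ^ 2 < 1 := pow_lt_one₀ (norm_nonneg _) hlt two_ne_zero
      have := mul_pos h2 (sub_pos.2 this)
      have := sq_nonneg (a x)
      simp only [d]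
      linarith
    · have := pow_pos (ha x heq) 2
      simpa [d, heq] using this
  have hcu : ContDiff ℝ 1 u := contDiff_id.sub hh
  have hca : ContDiff ℝ 1 a := contDiff_id.inner ℝ hcu
  have hcd : ContDiff ℝ 1 d :=
    (hca.pow 2).add ((hcu.norm_sq ℝ).mul (contDiff_const.sub (contDiff_id.norm_sq ℝ)))
  refine not_exists_contDiffAt_retraction_sphere (F := F)
    ⟨fun x => x + ((√(d x) - a x) / ‖u x‖ ^ 2) • u x, fun x hx => ?_, fun x hx => ?_,
      fun x hx => ?_⟩
  · have hdx := hd x (by simpa using hx)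
    exact contDiffAt_id.add ((((hcd.contDiffAt.sqrt hdx.ne').sub hca.contDiffAt).div
      (hcu.norm_sq ℝ).contDiffAt (pow_pos (hu x) 2).ne').smul hcu.contDiffAt)
  · have hs := Real.sq_sqrt (hd x (by simpa using hx)).le
    have hux := (hu x).ne'
    rw [← sq_eq_sq₀ (norm_nonneg _) zero_le_one, norm_add_sq_real, norm_smul, inner_smul_right,
      mul_pow, Real.norm_eq_abs, sq_abs]
    change ‖x‖ ^ 2 + 2 * ((√(d x) - a x) / ‖u x‖ ^ 2 * a x) + _ = _
    field_simp
    have hs : √(d x) ^ 2 = a x ^ 2 + ‖u x‖ ^ 2 * (1 - ‖x‖ ^ 2) := hs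
    linear_combination hs
  · have hx1 : ‖x‖ = 1 := by simpa using hx
    have : √(d x) = a x := by simp [d, hx1, Real.sqrt_sq (ha x hx1).le]
    simp [this]

/-- **Brouwer's fixed point theorem** for continuous maps into the unit ball. -/
theorem exists_eq_self_of_continuous_of_norm_le_one {F : Type*} [NormedAddCommGroup F]
    [InnerProductSpace ℝ F] [FiniteDimensional ℝ F] {f : F → F} (hf : Continuous f)
    (hle : ∀ x, ‖f x‖ ≤ 1) : ∃ x, f x = x := by
  obtain ⟨x₀, -, hmin⟩ := (isCompact_closedBall (0 : F) 1).exists_isMinOn ⟨0, by simp⟩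
    (hf.sub continuous_id).norm.continuousOn
  refine ⟨x₀, ?_⟩
  by_contra hne
  have hpos : 0 < ‖f x₀ - x₀‖ := norm_pos_iff.2 (sub_ne_zero.2 hne)
  set ε := ‖f x₀ - x₀‖ / 4 with hε
  have hεpos : 0 < ε := by positivity
  obtain ⟨g, hg, hgf, -⟩ := hf.exists_contDiff_approx 1 (continuous_const (y := ε)) fun _ => hεpos
  have hgle : ∀ x, ‖g x‖ ≤ 1 + ε := fun x => by
    have h1 := hgf x
    rw [dist_eq_norm, norm_sub_rev] at h1
    have h2 := norm_le_norm_add_norm_sub (f x) (g x)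
    have h3 := hle x
    linarith
  have hle' : ∀ x, ‖(1 + ε)⁻¹ • g x‖ ≤ 1 := fun x => by
    rw [norm_smul, norm_inv, Real.norm_of_nonneg (by positivity), inv_mul_le_one₀ (by positivity)]
    exact hgle x
  obtain ⟨x, hx⟩ := exists_eq_self_of_contDiff_of_norm_le_one (hg.const_smul (1 + ε)⁻¹) hle'
  have hx1 : ‖x‖ ≤ 1 := hx ▸ hle' x
  have hgx : g x = (1 + ε) • x := by
    conv_rhs => rw [← hx]
    rw [smul_inv_smul₀ (by positivity)]
  have h1 : ‖g x - x‖ ≤ ε := by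
    rw [hgx, add_smul, one_smul, add_sub_cancel_left, norm_smul, Real.norm_of_nonneg hεpos.le]
    exact mul_le_of_le_one_right hεpos.le hx1
  have h2 := hgf x
  rw [dist_eq_norm, norm_sub_rev] at h2
  have h3 : ‖f x₀ - x₀‖ ≤ ‖f x - x‖ := hmin (by simpa using hx1)
  have h4 := norm_sub_le_norm_sub_add_norm_sub (f x) (g x) x
  linarith

/-- The standard simplex is a retract of its ambient space. -/
theorem exists_continuous_retraction_stdSimplex (ι : Type*) [Fintype ι] [Nonempty ι] :
    ∃ p : (ι → ℝ) → ι → ℝ, Continuous p ∧ (∀ x, p x ∈ stdSimplex ℝ ι) ∧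
      ∀ x ∈ stdSimplex ℝ ι, p x = x := by
  let m : (ι → ℝ) → ℝ := fun x => ∑ i, max (x i) 0
  have hm : Continuous m := by fun_prop
  have hpos : ∀ x, 0 < max 1 (m x) := fun x => lt_max_of_lt_left one_pos
  refine ⟨fun x i => (max (x i) 0 + max (1 - m x) 0 / Fintype.card ι) / max 1 (m x), ?_,
    fun x => ⟨fun i => ?_, ?_⟩, fun x hx => ?_⟩
  · refine continuous_pi fun i => Continuous.div (by fun_prop) (by fun_prop) fun x => (hpos x).ne'
  · exact div_nonneg (by positivity) (hpos x).le
  · rw [← Finset.sum_div, div_eq_one_iff_eq (hpos x).ne', Finset.sum_add_distrib, Finset.sum_const,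
      Finset.card_univ, nsmul_eq_mul, mul_div_cancel₀ _ (by positivity)]
    change m x + _ = _
    rcases le_total (m x) 1 with h | h
    · rw [max_eq_left (by linarith), max_eq_left h]
      ring
    · rw [max_eq_right (by linarith), max_eq_right h, add_zero]
  · have h0 : ∀ i, max (x i) 0 = x i := fun i => max_eq_left (hx.1 i)
    have h1 : m x = 1 := by simp only [m, h0, hx.2]
    ext i
    simp [h0, h1]

/-- **Brouwer's fixed point theorem** on the standard simplex. -/
theorem exists_mem_stdSimplex_eq_self_of_continuousOn {ι : Type*} [Fintype ι] [Nonempty ι]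
    {f : (ι → ℝ) → ι → ℝ} (hf : ContinuousOn f (stdSimplex ℝ ι))
    (hmaps : MapsTo f (stdSimplex ℝ ι) (stdSimplex ℝ ι)) : ∃ x ∈ stdSimplex ℝ ι, f x = x := by
  obtain ⟨p, hp, hpmem, hpid⟩ := exists_continuous_retraction_stdSimplex ι
  have hfp : Continuous fun x => f (p x) := hf.comp_continuous hp hpmem
  let G : EuclideanSpace ℝ ι → EuclideanSpace ℝ ι := fun x => WithLp.toLp 2 (f (p x.ofLp))
  have hG : Continuous G :=
    (PiLp.continuous_toLp 2 _).comp (hfp.comp (PiLp.continuous_ofLp 2 _))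
  obtain ⟨x, hx⟩ := exists_eq_self_of_continuous_of_norm_le_one hG fun x => by
    obtain ⟨hnonneg, hsum⟩ := hmaps (hpmem x.ofLp)
    rw [EuclideanSpace.norm_eq, Real.sqrt_le_one, ← hsum]
    refine Finset.sum_le_sum fun i _ => ?_
    have hle : f (p x.ofLp) i ≤ 1 :=
      hsum ▸ Finset.single_le_sum (fun j _ => hnonneg j) (Finset.mem_univ i)
    simpa [G] using pow_le_of_le_one (hnonneg i) hle two_ne_zero
  have hx' : f (p x.ofLp) = x.ofLp := congrArg WithLp.ofLp hx
  have hmem : x.ofLp ∈ stdSimplex ℝ ι := hx' ▸ hmaps (hpmem x.ofLp)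
  exact ⟨x.ofLp, hmem, by rwa [hpid _ hmem] at hx'⟩

theorem exists_dist_map_self_le_of_totallyBounded {E : Type*} [NormedAddCommGroup E]
    [NormedSpace ℝ E] {C : Set E} (hne : C.Nonempty) (hconv : Convex ℝ C) {T : E → E}
    (hmaps : MapsTo T C C) (hcont : ContinuousOn T C) (htb : TotallyBounded (T '' C))
    {ε : ℝ} (hε : 0 < ε) : ∃ x ∈ C, dist (T x) x ≤ ε := by
  obtain ⟨N, hNsub, hNfin, hcover⟩ := Metric.finite_approx_of_totallyBounded htb ε hε
  have := hNfin.fintype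
  have hex : ∀ x ∈ C, ∃ y : N, dist (T x) y < ε := by
    intro x hx
    obtain ⟨y, hy, hxy⟩ := mem_iUnion₂.1 (hcover (mem_image_of_mem T hx))
    exact ⟨⟨y, hy⟩, hxy⟩
  have : Nonempty N := let ⟨x, hx⟩ := hne; ⟨(hex x hx).choose⟩
  let w : E → N → ℝ := fun x y => max (ε - dist (T x) y) 0
  let W : E → ℝ := fun x => ∑ y, w x y
  let S : (N → ℝ) → E := fun t => ∑ y, t y • (y : E)
  have hw : ∀ x y, 0 ≤ w x y := fun x y => le_max_right _ _
  have hW : ∀ x ∈ C, 0 < W x := by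
    intro x hx
    obtain ⟨y, hy⟩ := hex x hx
    exact Finset.sum_pos' (fun y _ => hw x y)
      ⟨y, Finset.mem_univ y, lt_max_of_lt_left (sub_pos.2 hy)⟩
  have hS : ∀ t ∈ stdSimplex ℝ N, S t ∈ C := fun t ht =>
    hconv.sum_mem (fun y _ => ht.1 y) ht.2 fun y _ => hmaps.image_subset (hNsub y.2)
  have hScont : Continuous S := by fun_prop
  have hTS : ContinuousOn (fun t => T (S t)) (stdSimplex ℝ N) := hcont.comp hScont.continuousOn hS
  have hwcont : ∀ y, ContinuousOn (fun t => w (S t) y) (stdSimplex ℝ N) := fun y =>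
    (continuousOn_const.sub (continuous_dist.comp_continuousOn (hTS.prodMk continuousOn_const))).sup
      continuousOn_const
  obtain ⟨t, ht, hfix⟩ := exists_mem_stdSimplex_eq_self_of_continuousOn
    (f := fun t y => w (S t) y / W (S t))
    (continuousOn_pi.2 fun y => (hwcont y).div (continuousOn_finsetSum _ fun y _ => hwcont y)
      fun t ht => (hW _ (hS t ht)).ne')
    (fun t ht => ⟨fun y => div_nonneg (hw _ y) (hW _ (hS t ht)).le, by
      rw [← Finset.sum_div]
      exact div_self (hW _ (hS t ht)).ne'⟩)
  refine ⟨S t, hS t ht, ?_⟩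
  -- the weights of `S t` are supported on the points of the net within `ε` of `T (S t)`
  have hclose : ∀ y : N, t y * dist (T (S t)) y ≤ t y * ε := by
    intro y
    rcases le_total (dist (T (S t)) y) ε with h | h
    · exact mul_le_mul_of_nonneg_left h (ht.1 y)
    · have : t y = 0 := by
        rw [← congrFun hfix y]
        simp [w, h]
      simp [this]
  calc dist (T (S t)) (S t) = ‖∑ y, t y • (T (S t) - (y : E))‖ := by
        rw [dist_eq_norm]
        simp only [smul_sub, Finset.sum_sub_distrib, ← Finset.sum_smul, ht.2, one_smul]
        rfl
    _ ≤ ∑ y, t y * dist (T (S t)) y := by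
        refine (norm_sum_le _ _).trans_eq (Finset.sum_congr rfl fun y _ => ?_)
        rw [norm_smul, Real.norm_of_nonneg (ht.1 y), dist_eq_norm]
    _ ≤ ∑ y, t y * ε := Finset.sum_le_sum fun y _ => hclose y
    _ = ε := by rw [← Finset.sum_mul, ht.2, one_mul]

/-- **Schauder's fixed point theorem**. -/
theorem exists_mem_eq_self_of_isCompact {E : Type*} [NormedAddCommGroup E] [NormedSpace ℝ E]
    {C K : Set E} (hne : C.Nonempty) (hclosed : IsClosed C) (hconv : Convex ℝ C) {T : E → E}
    (hmaps : MapsTo T C C) (hcont : ContinuousOn T C) (hK : IsCompact K) (hTK : MapsTo T C K) :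
    ∃ x ∈ C, T x = x := by
  have happrox : ∀ n : ℕ, ∃ x ∈ C, dist (T x) x ≤ 1 / ((n : ℝ) + 1) := fun n =>
    exists_dist_map_self_le_of_totallyBounded hne hconv hmaps hcont
      (hK.totallyBounded.subset hTK.image_subset) Nat.one_div_pos_of_nat
  choose x hxC hx using happrox
  obtain ⟨y, -, φ, hφ, hlim⟩ := hK.tendsto_subseq fun n => hTK (hxC n)
  have hdist : Tendsto (fun n => dist (T (x (φ n))) (x (φ n))) atTop (𝓝 0) :=
    squeeze_zero (fun _ => dist_nonneg) (fun n => hx (φ n))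
      (tendsto_one_div_add_atTop_nhds_zero_nat.comp hφ.tendsto_atTop)
  have hxlim : Tendsto (x ∘ φ) atTop (𝓝 y) := hlim.congr_dist hdist
  have hyC : y ∈ C := hclosed.mem_of_tendsto hxlim (Eventually.of_forall fun n => hxC _)
  have hTlim : Tendsto (T ∘ x ∘ φ) atTop (𝓝 (T y)) :=
    (hcont y hyC).tendsto.comp
      (tendsto_nhdsWithin_iff.2 ⟨hxlim, Eventually.of_forall fun n => hxC _⟩)
  exact ⟨y, hyC, tendsto_nhds_unique hTlim hlim⟩

/-- **Schaefer's fixed point theorem on a cone-like subset of a Banach space.**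
Let `P` be a nonempty closed convex subset of a real Banach space `E` which is stable under
multiplication by scalars in `[0,1]`. If `A : P → P` is continuous and compact (maps bounded
subsets of `P` into relatively compact sets), and the set of points `x ∈ P` with `x = λ • A x`
for some `λ ∈ [0,1]` is bounded, then `A` has a fixed point in `P`. -/
theorem schaefer_cone (E : Type*) [NormedAddCommGroup E] [NormedSpace ℝ E] [CompleteSpace E]
    (P : Set E) (hPne : P.Nonempty) (hPclosed : IsClosed P) (hPconv : Convex ℝ P)
    (hPcone : ∀ x ∈ P, ∀ l ∈ Icc (0:ℝ) 1, l • x ∈ P)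
    (A : E → E) (hmaps : MapsTo A P P) (hcont : ContinuousOn A P)
    (hcompact : ∀ s ⊆ P, Bornology.IsBounded s → IsCompact (closure (A '' s)))
    (hbdd : Bornology.IsBounded {x | x ∈ P ∧ ∃ l ∈ Icc (0:ℝ) 1, x = l • A x}) :
    ∃ x ∈ P, A x = x := by
  obtain ⟨R, hRpos, hR⟩ := hbdd.exists_pos_norm_lt
  have hzero : (0 : E) ∈ P := by
    obtain ⟨x, hx⟩ := hPne
    simpa using hPcone x hx 0 (by simp)
  let C : Set E := P ∩ closedBall 0 R
  -- `c x • A x` is the radial truncation of `A x` to the ball of radius `R`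
  let c : E → ℝ := fun x => R / max R ‖A x‖
  have hmax : ∀ x, 0 < max R ‖A x‖ := fun x => lt_max_of_lt_left hRpos
  have hc : ∀ x, c x ∈ Icc (0 : ℝ) 1 := fun x =>
    ⟨div_nonneg hRpos.le (hmax x).le, div_le_one_of_le₀ (le_max_left _ _) (hmax x).le⟩
  have hnorm : ∀ x, ‖c x • A x‖ = R * ‖A x‖ / max R ‖A x‖ := fun x => by
    rw [norm_smul, Real.norm_of_nonneg (hc x).1, div_mul_eq_mul_div]
  have hAC : ContinuousOn A C := hcont.mono inter_subset_left
  have hccont : ContinuousOn c C :=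
    continuousOn_const.div (continuousOn_const.sup hAC.norm) fun x _ => (hmax x).ne'
  have hK := (isCompact_Icc (a := (0 : ℝ)) (b := 1)).prod
    (hcompact C inter_subset_left (isBounded_closedBall.subset inter_subset_right))
  obtain ⟨x, hxC, hx⟩ := exists_mem_eq_self_of_isCompact (C := C) (T := fun x => c x • A x)
    ⟨0, hzero, by simpa using hRpos.le⟩ (hPclosed.inter isClosed_closedBall)
    (hPconv.inter (convex_closedBall 0 R))
    (fun x hx => ⟨hPcone _ (hmaps hx.1) _ (hc x), by
      rw [mem_closedBall_zero_iff, hnorm, div_le_iff₀ (hmax x)]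
      exact mul_le_mul_of_nonneg_left (le_max_right _ _) hRpos.le⟩)
    (hccont.smul hAC) (hK.image continuous_smul)
    (fun x hx => ⟨(c x, A x), ⟨hc x, subset_closure (mem_image_of_mem A hx)⟩, rfl⟩)
  refine ⟨x, hxC.1, ?_⟩
  have hlt : ‖x‖ < R := hR x ⟨hxC.1, c x, hc x, hx.symm⟩
  have hAx : ‖A x‖ ≤ R := by
    by_contra! h
    have := hnorm x
    rw [hx, max_eq_right h.le, mul_div_cancel_right₀ _ (hRpos.trans h).ne'] at this
    exact hlt.ne this
  have hc1 : c x = 1 := by simp only [c]; rw [max_eq_left hAx, div_self hRpos.ne']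
  simpa [hc1] using hx
end

section
/- Let ν ≥ 0 and let (u, θ) be a smooth solution of the regularized thermoelasticity system on [0,T]. Then for every t ∈ [0,T] the energy identity holds: (1/2)‖u_t(t)‖_{L²}² + (1/2)‖u_x(t)‖_{L²}² + ∫_a^b θ(t,x) dx + ν ∫₀ᵗ ‖u_tx(s)‖_{L²}² ds = (1/2)‖u₁‖_{L²}² + (1/2)‖(u₀)_x‖_{L²}² + ∫_a^b θ₀(x) dx. -/
open Set MeasureTheory

/-- Partial derivative in the first (time) variable. -/
noncomputable def pt (w : ℝ → ℝ → ℝ) (t x : ℝ) : ℝ := deriv (fun s => w s x) t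

/-- Partial derivative in the second (space) variable. -/
noncomputable def px (w : ℝ → ℝ → ℝ) (t x : ℝ) : ℝ := deriv (fun y => w t y) x

/-- Square of the L² norm on (a,b). -/
noncomputable def sqInt (a b : ℝ) (f : ℝ → ℝ) : ℝ := ∫ x in a..b, (f x) ^ 2

/-- The L² norm on (a,b). -/
noncomputable def L2norm (a b : ℝ) (f : ℝ → ℝ) : ℝ := Real.sqrt (sqInt a b f)

/-- A smooth solution of the regularized thermoelasticity system on [0,T] × [a,b]:
`u_tt − u_xx − ν u_txx = −μ θ_x`, `θ_t − θ_xx + μ θ u_tx = 0`,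
with Dirichlet boundary conditions for `u` and Neumann boundary conditions for `θ`. -/
def IsRegSolution (a b μ T ν : ℝ) (u θ : ℝ → ℝ → ℝ) : Prop :=
  ContDiff ℝ (⊤ : ℕ∞) (Function.uncurry u) ∧ ContDiff ℝ (⊤ : ℕ∞) (Function.uncurry θ) ∧
  (∀ t ∈ Set.Icc (0:ℝ) T, ∀ x ∈ Set.Icc a b,
      pt (pt u) t x - px (px u) t x - ν * px (px (pt u)) t x = -μ * px θ t x) ∧
  (∀ t ∈ Set.Icc (0:ℝ) T, ∀ x ∈ Set.Icc a b,
      pt θ t x - px (px θ) t x + μ * θ t x * px (pt u) t x = 0) ∧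
  (∀ t ∈ Set.Icc (0:ℝ) T, u t a = 0 ∧ u t b = 0) ∧
  (∀ t ∈ Set.Icc (0:ℝ) T, px θ t a = 0 ∧ px θ t b = 0)

theorem hasDerivAt_pt {w : ℝ → ℝ → ℝ} (hw : Differentiable ℝ (Function.uncurry w)) (t x : ℝ) :
    HasDerivAt (fun s => w s x) (pt w t x) t := by
  have h : DifferentiableAt ℝ (fun s => Function.uncurry w (s, x)) t := by fun_prop
  exact h.hasDerivAt

theorem hasDerivAt_px {w : ℝ → ℝ → ℝ} (hw : Differentiable ℝ (Function.uncurry w)) (t x : ℝ) :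
    HasDerivAt (fun y => w t y) (px w t x) x := by
  have h : DifferentiableAt ℝ (fun y => Function.uncurry w (t, y)) x := by fun_prop
  exact h.hasDerivAt

theorem pt_eq_fderiv {w : ℝ → ℝ → ℝ} (hw : Differentiable ℝ (Function.uncurry w)) (t x : ℝ) :
    pt w t x = fderiv ℝ (Function.uncurry w) (t, x) (1, 0) := by
  have h := (hw (t, x)).hasFDerivAt.comp_hasDerivAt t
    ((hasDerivAt_id t).prodMk (hasDerivAt_const t x))
  exact h.deriv

theorem px_eq_fderiv {w : ℝ → ℝ → ℝ} (hw : Differentiable ℝ (Function.uncurry w)) (t x : ℝ) :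
    px w t x = fderiv ℝ (Function.uncurry w) (t, x) (0, 1) := by
  have h := (hw (t, x)).hasFDerivAt.comp_hasDerivAt x
    ((hasDerivAt_const x t).prodMk (hasDerivAt_id x))
  exact h.deriv

theorem uncurry_pt {w : ℝ → ℝ → ℝ} (hw : Differentiable ℝ (Function.uncurry w)) :
    Function.uncurry (pt w) = fun p => fderiv ℝ (Function.uncurry w) p (1, 0) :=
  funext fun p => pt_eq_fderiv hw p.1 p.2

theorem uncurry_px {w : ℝ → ℝ → ℝ} (hw : Differentiable ℝ (Function.uncurry w)) :
    Function.uncurry (px w) = fun p => fderiv ℝ (Function.uncurry w) p (0, 1) :=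
  funext fun p => px_eq_fderiv hw p.1 p.2

theorem contDiff_pt {w : ℝ → ℝ → ℝ} (hw : ContDiff ℝ (⊤ : ℕ∞) (Function.uncurry w)) :
    ContDiff ℝ (⊤ : ℕ∞) (Function.uncurry (pt w)) := by
  rw [uncurry_pt (hw.differentiable (by simp))]
  exact (hw.fderiv_right (m := (⊤ : ℕ∞)) (by simp)).clm_apply contDiff_const

theorem contDiff_px {w : ℝ → ℝ → ℝ} (hw : ContDiff ℝ (⊤ : ℕ∞) (Function.uncurry w)) :
    ContDiff ℝ (⊤ : ℕ∞) (Function.uncurry (px w)) := by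
  rw [uncurry_px (hw.differentiable (by simp))]
  exact (hw.fderiv_right (m := (⊤ : ℕ∞)) (by simp)).clm_apply contDiff_const

theorem pt_px_comm {w : ℝ → ℝ → ℝ} (hw : ContDiff ℝ (⊤ : ℕ∞) (Function.uncurry w)) (t x : ℝ) :
    pt (px w) t x = px (pt w) t x := by
  have hd : Differentiable ℝ (Function.uncurry w) := hw.differentiable (by simp)
  have hd' : Differentiable ℝ (fderiv ℝ (Function.uncurry w)) :=
    (hw.fderiv_right (m := (⊤ : ℕ∞)) (by simp)).differentiable (by simp)
  rw [pt_eq_fderiv ((contDiff_px hw).differentiable (by simp)),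
    px_eq_fderiv ((contDiff_pt hw).differentiable (by simp)), uncurry_px hd, uncurry_pt hd,
    fderiv_clm_apply (hd' _) (differentiableAt_const _),
    fderiv_clm_apply (hd' _) (differentiableAt_const _)]
  have hsymm : IsSymmSndFDerivAt ℝ (Function.uncurry w) (t, x) :=
    hw.contDiffAt.isSymmSndFDerivAt
      (by simpa using WithTop.coe_le_coe.2 (le_top : (2 : ℕ∞) ≤ ⊤))
  simpa using hsymm (1, 0) (0, 1)

/-- A function vanishing on an interval of positive length has zero derivative on it,
endpoints included. -/
theorem HasDerivAt.eq_zero_of_eqOn_Icc {f : ℝ → ℝ} {f' T t : ℝ} (hT : 0 < T)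
    (ht : t ∈ Icc 0 T) (hf : HasDerivAt f f' t) (h0 : ∀ s ∈ Icc 0 T, f s = 0) : f' = 0 :=
  (uniqueDiffOn_Icc hT t ht).eq_deriv _ hf.hasDerivWithinAt
    ((hasDerivWithinAt_const t (Icc 0 T) (0 : ℝ)).congr h0 (h0 t ht))

/-- Integral form of a conservation law `e_t + d = G_x` whose flux `G` vanishes on the lateral
boundary. -/
theorem integral_balance {a b t : ℝ} (hab : a ≤ b) (ht : 0 ≤ t) {e d G : ℝ → ℝ → ℝ}
    (he : ContDiff ℝ (⊤ : ℕ∞) (Function.uncurry e)) (hd : Continuous (Function.uncurry d))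
    (hG : ContDiff ℝ (⊤ : ℕ∞) (Function.uncurry G))
    (hlaw : ∀ s ∈ Icc 0 t, ∀ x ∈ Icc a b, pt e s x + d s x = px G s x)
    (hbd : ∀ s ∈ Icc 0 t, G s a = 0 ∧ G s b = 0) :
    (∫ x in a..b, e t x) + ∫ s in (0 : ℝ)..t, ∫ x in a..b, d s x = ∫ x in a..b, e 0 x := by
  have hec : Continuous (Function.uncurry e) := he.continuous
  have hpt : Continuous (Function.uncurry (pt e)) := (contDiff_pt he).continuous
  have hpx : Continuous (Function.uncurry (px G)) := (contDiff_px hG).continuous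
  have hslice : ∀ {w : ℝ → ℝ → ℝ}, Continuous (Function.uncurry w) → ∀ s, Continuous (w s) :=
    fun hw s => hw.comp (Continuous.prodMk_right s)
  have htime : ∀ x, ∫ s in (0 : ℝ)..t, pt e s x = e t x - e 0 x := fun x =>
    intervalIntegral.integral_eq_sub_of_hasDerivAt
      (fun s _ => hasDerivAt_pt (he.differentiable (by simp)) s x)
      ((hpt.comp (Continuous.prodMk_left x)).intervalIntegrable _ _)
  have hspace : ∀ s ∈ Icc 0 t, ∫ x in a..b, pt e s x = -∫ x in a..b, d s x := by
    intro s hs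
    have h1 : ∫ x in a..b, px G s x = 0 := by
      rw [intervalIntegral.integral_eq_sub_of_hasDerivAt
        (fun x _ => hasDerivAt_px (hG.differentiable (by simp)) s x)
        ((hslice hpx s).intervalIntegrable _ _), (hbd s hs).1, (hbd s hs).2, sub_zero]
    have h2 : ∫ x in a..b, (pt e s x + d s x) = ∫ x in a..b, px G s x :=
      intervalIntegral.integral_congr fun x hx => hlaw s hs x (uIcc_of_le hab ▸ hx)
    rw [intervalIntegral.integral_add ((hslice hpt s).intervalIntegrable _ _)
      ((hslice hd s).intervalIntegrable _ _)] at h2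
    linarith
  have hswap : ∫ x in a..b, ∫ s in (0 : ℝ)..t, pt e s x
      = ∫ s in (0 : ℝ)..t, ∫ x in a..b, pt e s x := by
    refine (intervalIntegral_intervalIntegral_swap (F := pt e) ?_).symm
    exact (hpt.continuousOn.integrableOn_compact (isCompact_uIcc.prod isCompact_uIcc)).mono_set
      (prod_mono uIoc_subset_uIcc uIoc_subset_uIcc)
  have hrate : ∫ s in (0 : ℝ)..t, ∫ x in a..b, pt e s x
      = -∫ s in (0 : ℝ)..t, ∫ x in a..b, d s x := by
    rw [← intervalIntegral.integral_neg]
    exact intervalIntegral.integral_congr fun s hs => hspace s (uIcc_of_le ht ▸ hs)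
  have hdiff : ∫ x in a..b, ∫ s in (0 : ℝ)..t, pt e s x
      = (∫ x in a..b, e t x) - ∫ x in a..b, e 0 x := by
    simp only [htime]
    exact intervalIntegral.integral_sub ((hslice hec t).intervalIntegrable _ _)
      ((hslice hec 0).intervalIntegrable _ _)
  linarith

/-- **Energy identity for the regularized thermoelasticity system**: for every `t ∈ [0,T]`,
`(1/2)‖u_t(t)‖² + (1/2)‖u_x(t)‖² + ∫ θ(t) + ν ∫₀ᵗ ‖u_tx‖²
  = (1/2)‖u₁‖² + (1/2)‖(u₀)_x‖² + ∫ θ₀`. -/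
theorem energy_identity (a b μ T ν : ℝ) (hab : a < b) (hμ : 0 < μ) (hT : 0 < T) (hν : 0 ≤ ν)
    (u θ : ℝ → ℝ → ℝ) (hsol : IsRegSolution a b μ T ν u θ) :
    ∀ t ∈ Icc (0:ℝ) T,
      (1/2) * sqInt a b (fun x => pt u t x) + (1/2) * sqInt a b (fun x => px u t x)
          + (∫ x in a..b, θ t x)
          + ν * ∫ s in (0:ℝ)..t, sqInt a b (fun x => px (pt u) s x)
        = (1/2) * sqInt a b (fun x => pt u 0 x) + (1/2) * sqInt a b (fun x => px u 0 x)
          + ∫ x in a..b, θ 0 x := by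
  obtain ⟨hu, hθ, hmom, heat, hDir, hNeu⟩ := hsol
  intro t ht
  have hut := contDiff_pt hu
  have hux := contDiff_px hu
  have hutx := contDiff_px hut
  have hθx := contDiff_px hθ
  have hslice : ∀ {w : ℝ → ℝ → ℝ}, ContDiff ℝ (⊤ : ℕ∞) (Function.uncurry w) →
      ∀ s, Continuous (w s) := fun hw s => hw.continuous.comp (Continuous.prodMk_right s)
  have hsub : ∀ s ∈ Icc 0 t, s ∈ Icc 0 T := fun s hs => ⟨hs.1, hs.2.trans ht.2⟩
  have hDt : ∀ {w : ℝ → ℝ → ℝ}, ContDiff ℝ (⊤ : ℕ∞) (Function.uncurry w) → ∀ s x,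
      HasDerivAt (fun r => w r x) (pt w s x) s :=
    fun hw => hasDerivAt_pt (hw.differentiable (by simp))
  have hDx : ∀ {w : ℝ → ℝ → ℝ}, ContDiff ℝ (⊤ : ℕ∞) (Function.uncurry w) → ∀ s x,
      HasDerivAt (fun y => w s y) (px w s x) x :=
    fun hw => hasDerivAt_px (hw.differentiable (by simp))
  have hbal := integral_balance hab.le ht.1
    (e := fun s x => (1/2) * pt u s x ^ 2 + (1/2) * px u s x ^ 2 + θ s x)
    (d := fun s x => ν * px (pt u) s x ^ 2)
    (G := fun s x => pt u s x * px u s x + ν * (pt u s x * px (pt u) s x)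
      - μ * (pt u s x * θ s x) + px θ s x)
    (((contDiff_const.mul (hut.pow 2)).add (contDiff_const.mul (hux.pow 2))).add hθ)
    ((contDiff_const (c := ν)).mul (hutx.pow 2)).continuous
    ((((hut.mul hux).add (contDiff_const.mul (hut.mul hutx))).sub
      (contDiff_const.mul (hut.mul hθ))).add hθx)
    (by
      intro s hs x hx
      have he := ((((hDt hut s x).pow 2).const_mul (1/2)).add
        (((hDt hux s x).pow 2).const_mul (1/2))).add (hDt hθ s x)
      have hG := ((((hDx hut s x).mul (hDx hux s x)).add
        (((hDx hut s x).mul (hDx hutx s x)).const_mul ν)).sub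
        (((hDx hut s x).mul (hDx hθ s x)).const_mul μ)).add (hDx hθx s x)
      refine (congrArg (· + _) he.deriv).trans (Eq.trans ?_ hG.deriv.symm)
      have hm := hmom s (hsub s hs) x hx
      have hh := heat s (hsub s hs) x hx
      rw [pt_px_comm hu]
      push_cast
      linear_combination pt u s x * hm + hh)
    (by
      intro s hs
      have hs' := hsub s hs
      have hA : pt u s a = 0 :=
        (hDt hu s a).eq_zero_of_eqOn_Icc hT hs' fun r hr => (hDir r hr).1
      have hB : pt u s b = 0 :=
        (hDt hu s b).eq_zero_of_eqOn_Icc hT hs' fun r hr => (hDir r hr).2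
      simp [hA, hB, hNeu s hs'])
  have hsplit : ∀ s, ∫ x in a..b, ((1/2) * pt u s x ^ 2 + (1/2) * px u s x ^ 2 + θ s x)
      = (1/2) * sqInt a b (fun x => pt u s x) + (1/2) * sqInt a b (fun x => px u s x)
        + ∫ x in a..b, θ s x := by
    intro s
    have h1 : Continuous fun x => (1/2) * pt u s x ^ 2 :=
      continuous_const.mul ((hslice hut s).pow 2)
    have h2 : Continuous fun x => (1/2) * px u s x ^ 2 :=
      continuous_const.mul ((hslice hux s).pow 2)
    rw [intervalIntegral.integral_add ((h1.intervalIntegrable _ _).add (h2.intervalIntegrable _ _))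
        ((hslice hθ s).intervalIntegrable _ _),
      intervalIntegral.integral_add (h1.intervalIntegrable _ _) (h2.intervalIntegrable _ _),
      intervalIntegral.integral_const_mul, intervalIntegral.integral_const_mul]
    rfl
  simp only [hsplit, intervalIntegral.integral_const_mul] at hbal
  exact hbal
end
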